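/- Let S = {x ∈ ℝⁿ : g₁(x) ≥ 0, …, g_m(x) ≥ 0}. For e ∈ 𝓔 := {0,1}ⁿ, let S_e := {x ∈ ℝⁿ : g_i(x) ≥ 0 (i = 1,…,m), (−1)^{e_j} x_j ≥ 0 (j = 1,…,n)} with generating set G_e := {g₁,…,g_m, (−1)^{e_1}X₁, …, (−1)^{e_n}X_n}, and define S̃_e and G̃_e from G_e in the same way S̃ and G̃ are defined from G. Assume: (1) S is closed at ∞; (2) there is a common order k′ such that the PP-BDR property holds for S̃_e (with generating set G̃_e) with order k′ for every e ∈ 𝓔. Then closure(conv(S)) = closure(conv(⋃_{e∈𝓔} Ω_{k′}(G̃_e))); in particular, closure(conv(S)) is the closure of a projected spectrahedron. -/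

import Mathlib

open MvPolynomial Pointwise

/-- Homogenization of a polynomial in variables `X₁,…,Xₙ` (indexed by `Fin n`, shifted to
`X₁,…,Xₙ` via `Fin.succ`) with a new homogenizing variable `X₀`. -/
noncomputable def homog {n : ℕ} (f : MvPolynomial (Fin n) ℝ) : MvPolynomial (Fin (n + 1)) ℝ :=
  ∑ α ∈ f.support,
    MvPolynomial.monomial
      (Finsupp.mapDomain Fin.succ α + Finsupp.single 0 (f.totalDegree - α.sum fun _ e => e))
      (MvPolynomial.coeff α f)

/-- The `k`-th truncated quadratic module generated by the family `g`. -/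
def QMod {τ ι : Type*} [Fintype ι] (k : ℕ) (g : ι → MvPolynomial τ ℝ) :
    Set (MvPolynomial τ ℝ) :=
  {p | ∃ s₀ : MvPolynomial τ ℝ, ∃ s : ι → MvPolynomial τ ℝ,
      IsSumSq s₀ ∧ s₀.totalDegree ≤ 2 * k ∧
      (∀ i, IsSumSq (s i) ∧ (s i * g i).totalDegree ≤ 2 * k) ∧
      p = s₀ + ∑ i, s i * g i}

/-- The homogenized generating family `G̃`. -/
noncomputable def tGens {n : ℕ} {ι : Type*} (g : ι → MvPolynomial (Fin n) ℝ) :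
    ι ⊕ Fin 3 → MvPolynomial (Fin (n + 1)) ℝ :=
  Sum.elim (fun j => homog (g j))
    ![X 0, (∑ i, X i ^ 2) - 1, 1 - ∑ i, X i ^ 2]

/-- The modified theta body `TH̃ₖ(G̃)`. -/
noncomputable def thetaB {n : ℕ} {ι : Type*} [Fintype ι] (k : ℕ)
    (g : ι → MvPolynomial (Fin n) ℝ) : Set (Fin n → ℝ) :=
  {x | ∀ l ∈ QMod k (tGens g), l.IsHomogeneous 1 → 0 ≤ eval (Fin.cons 1 x) l}

/-- The Riesz functional of a truncated moment sequence. -/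
noncomputable def riesz {m : ℕ} (y : (Fin m →₀ ℕ) → ℝ) (p : MvPolynomial (Fin m) ℝ) : ℝ :=
  ∑ α ∈ p.support, MvPolynomial.coeff α p * y α

/-- The moment relaxation `Ωₖ(G̃)`. -/
noncomputable def omegaRel {n : ℕ} {ι : Type*} [Fintype ι] (k : ℕ)
    (g : ι → MvPolynomial (Fin n) ℝ) : Set (Fin n → ℝ) :=
  {x | ∃ y : (Fin (n + 1) →₀ ℕ) → ℝ,
      riesz y (X 0) = 1 ∧
      (∀ i : Fin n, riesz y (X i.succ) = x i) ∧
      (∀ q : MvPolynomial (Fin (n + 1)) ℝ, q.totalDegree ≤ k → 0 ≤ riesz y (q ^ 2)) ∧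
      (∀ q : MvPolynomial (Fin (n + 1)) ℝ, q.totalDegree ≤ k - 1 → 0 ≤ riesz y (X 0 * q ^ 2)) ∧
      (∀ q : MvPolynomial (Fin (n + 1)) ℝ, q.totalDegree ≤ 2 * (k - 1) →
        riesz y (((∑ i, X i ^ 2) - 1) * q) = 0) ∧
      (∀ j : ι, ∀ q : MvPolynomial (Fin (n + 1)) ℝ,
        q.totalDegree ≤ k - ((g j).totalDegree + 1) / 2 → 0 ≤ riesz y (homog (g j) * q ^ 2))}

/-- The basic semialgebraic set defined by the family `g`. -/
def semiS {n : ℕ} {ι : Type*} (g : ι → MvPolynomial (Fin n) ℝ) : Set (Fin n → ℝ) :=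
  {x | ∀ j, 0 ≤ eval x (g j)}

/-- `S̃ᵒ`. -/
noncomputable def StO {n : ℕ} {ι : Type*} (g : ι → MvPolynomial (Fin n) ℝ) :
    Set (Fin (n + 1) → ℝ) :=
  {x | (∀ j, 0 ≤ eval x (homog (g j))) ∧ 0 < x 0}

/-- `S̃ᶜ`. -/
noncomputable def StC {n : ℕ} {ι : Type*} (g : ι → MvPolynomial (Fin n) ℝ) :
    Set (Fin (n + 1) → ℝ) :=
  {x | (∀ j, 0 ≤ eval x (homog (g j))) ∧ 0 ≤ x 0}

/-- `S̃ = S̃ᶜ ∩ {‖x̃‖₂ = 1}`. -/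
noncomputable def StS {n : ℕ} {ι : Type*} (g : ι → MvPolynomial (Fin n) ℝ) :
    Set (Fin (n + 1) → ℝ) :=
  {x | (∀ j, 0 ≤ eval x (homog (g j))) ∧ 0 ≤ x 0 ∧ ∑ i, x i ^ 2 = 1}

/-- Assumption A: `S` is closed at infinity, and `conv(closure(S̃ᵒ))` is closed and pointed. -/
noncomputable def AssumpA {n : ℕ} {ι : Type*} (g : ι → MvPolynomial (Fin n) ℝ) : Prop :=
  closure (StO g) = StC g ∧ IsClosed (convexHull ℝ (closure (StO g))) ∧
    convexHull ℝ (closure (StO g)) ∩ -(convexHull ℝ (closure (StO g))) = {0}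

/-- The PP-BDR property with order `k` for the set `T ⊆ ℝⁿ⁺¹` relative to the homogenized
generating family `tGens g`: outside a Lebesgue-null set of coefficient vectors, every affine
polynomial positive on `T` lies in the `k`-th truncated quadratic module of `G̃`. -/
noncomputable def ppBDR {n : ℕ} {ι : Type*} [Fintype ι] (k : ℕ)
    (g : ι → MvPolynomial (Fin n) ℝ) (T : Set (Fin (n + 1) → ℝ)) : Prop :=
  MeasureTheory.volume {c : Fin (n + 2) → ℝ |
    (∀ x ∈ T, 0 < c 0 + ∑ i : Fin (n + 1), c i.succ * x i) ∧
    (C (c 0) + ∑ i : Fin (n + 1), C (c i.succ) * X i) ∉ QMod k (tGens g)} = 0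

lemma riesz_eq_sum {m : ℕ} (y : (Fin m →₀ ℕ) → ℝ) (p : MvPolynomial (Fin m) ℝ)
    (s : Finset (Fin m →₀ ℕ)) (hs : p.support ⊆ s) :
    riesz y p = ∑ α ∈ s, MvPolynomial.coeff α p * y α := by
  unfold riesz
  refine Finset.sum_subset hs ?_
  intro α _ h
  rw [MvPolynomial.notMem_support_iff.mp h, zero_mul]

lemma riesz_add {m : ℕ} (y : (Fin m →₀ ℕ) → ℝ) (p q : MvPolynomial (Fin m) ℝ) :
    riesz y (p + q) = riesz y p + riesz y q := by
  classical
  rw [riesz_eq_sum y (p + q) (p.support ∪ q.support) MvPolynomial.support_add,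
    riesz_eq_sum y p (p.support ∪ q.support) Finset.subset_union_left,
    riesz_eq_sum y q (p.support ∪ q.support) Finset.subset_union_right,
    ← Finset.sum_add_distrib]
  refine Finset.sum_congr rfl fun α _ => ?_
  rw [MvPolynomial.coeff_add, add_mul]

lemma riesz_C_mul {m : ℕ} (y : (Fin m →₀ ℕ) → ℝ) (c : ℝ) (p : MvPolynomial (Fin m) ℝ) :
    riesz y (C c * p) = c * riesz y p := by
  rw [riesz_eq_sum y (C c * p) p.support, riesz, Finset.mul_sum]
  · refine Finset.sum_congr rfl fun α _ => ?_
    rw [MvPolynomial.coeff_C_mul, mul_assoc]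
  · intro α h
    rw [MvPolynomial.mem_support_iff, MvPolynomial.coeff_C_mul] at h
    exact MvPolynomial.mem_support_iff.mpr (right_ne_zero_of_mul h)

lemma riesz_zero {m : ℕ} (y : (Fin m →₀ ℕ) → ℝ) : riesz y 0 = 0 := by
  simp [riesz]

lemma riesz_neg {m : ℕ} (y : (Fin m →₀ ℕ) → ℝ) (p : MvPolynomial (Fin m) ℝ) :
    riesz y (-p) = - riesz y p := by
  have h := riesz_add y p (-p)
  rw [add_neg_cancel, riesz_zero] at h
  linarith

lemma riesz_sum {m : ℕ} (y : (Fin m →₀ ℕ) → ℝ) {ι : Type*} (s : Finset ι)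
    (p : ι → MvPolynomial (Fin m) ℝ) :
    riesz y (∑ i ∈ s, p i) = ∑ i ∈ s, riesz y (p i) := by
  classical
  induction s using Finset.induction_on with
  | empty => simp [riesz_zero]
  | insert a s ha ih => rw [Finset.sum_insert ha, Finset.sum_insert ha, riesz_add, ih]

lemma riesz_dirac {m : ℕ} (N : ℝ) (x : Fin m → ℝ) (p : MvPolynomial (Fin m) ℝ) :
    riesz (fun α => N * ∏ i ∈ α.support, x i ^ α i) p = N * eval x p := by
  rw [riesz, MvPolynomial.eval_eq, Finset.mul_sum]
  exact Finset.sum_congr rfl fun α _ => by ring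

lemma eval_homog {n : ℕ} (f : MvPolynomial (Fin n) ℝ) (t : ℝ) (x : Fin n → ℝ) :
    eval (t • (Fin.cons 1 x : Fin (n + 1) → ℝ)) (homog f) = t ^ f.totalDegree * eval x f := by
  rw [homog, map_sum, MvPolynomial.eval_eq' x f, Finset.mul_sum]
  refine Finset.sum_congr rfl fun α hα => ?_
  have hd : (α.sum fun _ e => e) ≤ f.totalDegree := MvPolynomial.le_totalDegree hα
  have hs : (α.sum fun _ e => e) = ∑ i, α i := Finsupp.sum_fintype _ _ (fun _ => rfl)
  rw [MvPolynomial.eval_monomial, Finsupp.prod_fintype _ _ (fun _ => by simp),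
    Fin.prod_univ_succ]
  have h0 : Finsupp.mapDomain Fin.succ α (0 : Fin (n + 1)) = 0 := by
    apply Finsupp.mapDomain_of_notMem_range
    rintro ⟨i, hi⟩
    exact Fin.succ_ne_zero i hi
  have h1 : ∀ i : Fin n, Finsupp.mapDomain Fin.succ α i.succ = α i := fun i =>
    Finsupp.mapDomain_apply (Fin.succ_injective n) α i
  simp only [Finsupp.add_apply, h0, h1, Finsupp.single_apply, Pi.smul_apply, Fin.cons_zero,
    Fin.cons_succ, smul_eq_mul, mul_one, zero_add, if_true, (Fin.succ_ne_zero _).symm, if_false,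
    add_zero, mul_pow, Finset.prod_mul_distrib, Finset.prod_pow_eq_pow_sum]
  rw [← hs]
  have : t ^ f.totalDegree = t ^ (f.totalDegree - α.sum fun _ e => e) *
      t ^ (α.sum fun _ e => e) := by
    rw [← pow_add, Nat.sub_add_cancel hd]
  rw [this]
  ring

lemma eval_homog_one {n : ℕ} (f : MvPolynomial (Fin n) ℝ) (x : Fin n → ℝ) :
    eval (Fin.cons 1 x : Fin (n + 1) → ℝ) (homog f) = eval x f := by
  simpa using eval_homog f 1 x

lemma homog_isHomogeneous {n : ℕ} (f : MvPolynomial (Fin n) ℝ) :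
    (homog f).IsHomogeneous f.totalDegree := by
  refine MvPolynomial.IsHomogeneous.sum _ _ _ fun α hα => ?_
  refine MvPolynomial.isHomogeneous_monomial _ ?_
  have hd : (α.sum fun _ e => e) ≤ f.totalDegree := MvPolynomial.le_totalDegree hα
  have h2 : (Finsupp.mapDomain Fin.succ α).degree = α.sum fun _ e => e := by
    rw [Finsupp.degree_eq_sum, Fin.sum_univ_succ]
    have h0 : Finsupp.mapDomain Fin.succ α (0 : Fin (n + 1)) = 0 := by
      apply Finsupp.mapDomain_of_notMem_range
      rintro ⟨i, hi⟩
      exact Fin.succ_ne_zero i hi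
    have h1 : ∀ i : Fin n, Finsupp.mapDomain Fin.succ α i.succ = α i := fun i =>
      Finsupp.mapDomain_apply (Fin.succ_injective n) α i
    simp only [h0, h1, zero_add]
    exact (Finsupp.sum_fintype α (fun _ e => e) (fun _ => rfl)).symm
  rw [map_add, h2, Finsupp.degree_single]
  omega

lemma homog_ne_zero {n : ℕ} {f : MvPolynomial (Fin n) ℝ} (hf : f ≠ 0) : homog f ≠ 0 := by
  intro h
  apply hf
  apply MvPolynomial.funext
  intro x
  rw [← eval_homog_one, h, map_zero, map_zero]

lemma totalDegree_homog {n : ℕ} {f : MvPolynomial (Fin n) ℝ} (h : homog f ≠ 0) :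
    (homog f).totalDegree = f.totalDegree :=
  (homog_isHomogeneous f).totalDegree h

open MonomialOrder in
lemma lead_nonneg_add {m : ℕ} {a b : MvPolynomial (Fin m) ℝ}
    (ha : 0 ≤ (degLex : MonomialOrder (Fin m)).leadingCoeff a)
    (hb : 0 ≤ (degLex : MonomialOrder (Fin m)).leadingCoeff b) :
    0 ≤ (degLex : MonomialOrder (Fin m)).leadingCoeff (a + b) ∧
      a.totalDegree ≤ (a + b).totalDegree ∧ b.totalDegree ≤ (a + b).totalDegree := by
  set o := (degLex : MonomialOrder (Fin m)) with ho
  rcases lt_trichotomy (o.toSyn (o.degree a)) (o.toSyn (o.degree b)) with h | h | h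
  · have hd := o.degree_add_eq_right_of_lt h
    have hl : o.leadingCoeff (a + b) = o.leadingCoeff b := by
      rw [add_comm]; exact o.leadingCoeff_add_of_lt h
    refine ⟨hl ▸ hb, ?_, ?_⟩
    · apply degLex_totalDegree_monotone; rw [← ho, hd]; exact h.le
    · apply degLex_totalDegree_monotone; rw [← ho, hd]
  · have hE : o.degree a = o.degree b := o.toSyn.injective h
    by_cases ha0 : a = 0
    · subst ha0; simpa using hb
    have hapos : 0 < o.leadingCoeff a :=
      lt_of_le_of_ne ha (Ne.symm (o.leadingCoeff_ne_zero_iff.mpr ha0))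
    have hd : o.degree (a + b) = o.degree a := by
      apply o.toSyn.injective
      apply le_antisymm
      · refine o.degree_add_le.trans ?_
        rw [h, sup_idem]
      · apply o.le_degree
        rw [MvPolynomial.mem_support_iff, MvPolynomial.coeff_add]
        have : coeff (o.degree a) b = o.leadingCoeff b := by rw [hE]; rfl
        rw [this]
        have : coeff (o.degree a) a = o.leadingCoeff a := rfl
        rw [this]
        positivity
    refine ⟨?_, ?_, ?_⟩
    · unfold MonomialOrder.leadingCoeff
      rw [hd, MvPolynomial.coeff_add]
      refine add_nonneg ha ?_
      rw [hE]; exact hb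
    · apply degLex_totalDegree_monotone; rw [← ho, hd]
    · apply degLex_totalDegree_monotone; rw [← ho, hd, hE]
  · have hd := o.degree_add_of_lt h
    have hl : o.leadingCoeff (a + b) = o.leadingCoeff a := o.leadingCoeff_add_of_lt h
    refine ⟨hl ▸ ha, ?_, ?_⟩
    · apply degLex_totalDegree_monotone; rw [← ho, hd]
    · apply degLex_totalDegree_monotone; rw [← ho, hd]; exact h.le

open MonomialOrder in
lemma lead_nonneg_sumSq {m : ℕ} {s : MvPolynomial (Fin m) ℝ} (hs : IsSumSq s) :
    0 ≤ (degLex : MonomialOrder (Fin m)).leadingCoeff s := by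
  induction hs with
  | zero => simp
  | sq_add a hs ih =>
    refine (lead_nonneg_add ?_ ih).1
    rw [MonomialOrder.leadingCoeff_mul]
    exact mul_self_nonneg _

/-- A linear functional nonnegative on `h * q ^ 2` for `2 deg q ≤ N` is nonnegative on `h * s` for
sums of squares `s` of degree at most `N`. -/
lemma riesz_sumSq {m : ℕ} (y : (Fin m →₀ ℕ) → ℝ) (h : MvPolynomial (Fin m) ℝ) (N : ℕ)
    (H : ∀ q : MvPolynomial (Fin m) ℝ, 2 * q.totalDegree ≤ N → 0 ≤ riesz y (h * q ^ 2))
    {s : MvPolynomial (Fin m) ℝ} (hs : IsSumSq s) (hN : s.totalDegree ≤ N) :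
    0 ≤ riesz y (h * s) := by
  induction hs with
  | zero => simp [riesz_zero]
  | @sq_add a s hs ih =>
    have hh := lead_nonneg_add (a := a * a) (b := s)
      (lead_nonneg_sumSq (IsSumSq.mul_self a)) (lead_nonneg_sumSq hs)
    rw [mul_add, riesz_add]
    refine add_nonneg ?_ (ih (hh.2.2.trans hN))
    rw [← pow_two]
    apply H
    by_cases ha : a = 0
    · simp [ha]
    · have := totalDegree_mul_of_isDomain ha ha
      omega

lemma totalDegree_sphere (n : ℕ) :
    2 ≤ ((∑ i : Fin (n + 1), X i ^ 2) - 1 : MvPolynomial (Fin (n + 1)) ℝ).totalDegree := by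
  have hc : coeff (Finsupp.single 0 2)
      ((∑ i : Fin (n + 1), X i ^ 2) - 1 : MvPolynomial (Fin (n + 1)) ℝ) = 1 := by
    rw [MvPolynomial.coeff_sub, MvPolynomial.coeff_sum, Finset.sum_eq_single 0]
    · rw [MvPolynomial.coeff_one, MvPolynomial.coeff_X_pow]
      have h0 : (0 : Fin (n + 1) →₀ ℕ) ≠ Finsupp.single 0 2 := by
        intro h
        have := DFunLike.congr_fun h 0
        simp at this
      rw [if_pos rfl, if_neg h0, sub_zero]
    · intro i _ hi
      rw [MvPolynomial.coeff_X_pow, if_neg]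
      intro h
      rw [Finsupp.single_left_inj (by norm_num)] at h
      exact hi h
    · simp
  have : (Finsupp.single (0 : Fin (n + 1)) 2) ∈
      ((∑ i : Fin (n + 1), X i ^ 2) - 1 : MvPolynomial (Fin (n + 1)) ℝ).support := by
    rw [MvPolynomial.mem_support_iff, hc]; exact one_ne_zero
  have h := MvPolynomial.le_totalDegree this
  simpa using h

lemma ne_zero_of_two_le {m : ℕ} {p : MvPolynomial (Fin m) ℝ} (h : 2 ≤ p.totalDegree) : p ≠ 0 := by
  rintro rfl
  simp at h

/-- Moment sequences feasible for `omegaRel` are nonnegative on the truncated quadratic module. -/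
lemma riesz_QMod {n : ℕ} {ι : Type*} [Fintype ι] (k : ℕ) (g : ι → MvPolynomial (Fin n) ℝ)
    (y : (Fin (n + 1) →₀ ℕ) → ℝ)
    (h1 : ∀ q : MvPolynomial (Fin (n + 1)) ℝ, q.totalDegree ≤ k → 0 ≤ riesz y (q ^ 2))
    (h2 : ∀ q : MvPolynomial (Fin (n + 1)) ℝ, q.totalDegree ≤ k - 1 → 0 ≤ riesz y (X 0 * q ^ 2))
    (h3 : ∀ q : MvPolynomial (Fin (n + 1)) ℝ, q.totalDegree ≤ 2 * (k - 1) →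
        riesz y (((∑ i, X i ^ 2) - 1) * q) = 0)
    (h4 : ∀ j : ι, ∀ q : MvPolynomial (Fin (n + 1)) ℝ,
        q.totalDegree ≤ k - ((g j).totalDegree + 1) / 2 → 0 ≤ riesz y (homog (g j) * q ^ 2))
    {p : MvPolynomial (Fin (n + 1)) ℝ} (hp : p ∈ QMod k (tGens g)) : 0 ≤ riesz y p := by
  obtain ⟨s₀, s, hs₀, hd₀, hs, rfl⟩ := hp
  have hsph : ∀ t : MvPolynomial (Fin (n + 1)) ℝ,
      (t * ((∑ i, X i ^ 2) - 1)).totalDegree ≤ 2 * k →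
      riesz y (((∑ i, X i ^ 2) - 1) * t) = 0 := by
    intro t ht
    by_cases ht0 : t = 0
    · simp [ht0, riesz_zero]
    have hD := totalDegree_sphere n
    rw [totalDegree_mul_of_isDomain ht0 (ne_zero_of_two_le hD)] at ht
    apply h3
    omega
  rw [riesz_add, riesz_sum]
  refine add_nonneg ?_ (Finset.sum_nonneg fun i _ => ?_)
  · have := riesz_sumSq y 1 (2 * k) (fun q hq => by
      rw [one_mul]; exact h1 q (by omega)) hs₀ hd₀
    simpa using this
  · obtain ⟨hsi, hdi⟩ := hs i
    rw [mul_comm]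
    by_cases hs0 : s i = 0
    · simp [hs0, riesz_zero]
    rcases i with j | i
    · change (s (Sum.inl j) * homog (g j)).totalDegree ≤ 2 * k at hdi
      change 0 ≤ riesz y (homog (g j) * s (Sum.inl j))
      by_cases hg0 : homog (g j) = 0
      · simp [hg0, riesz_zero]
      rw [totalDegree_mul_of_isDomain hs0 hg0, totalDegree_homog hg0] at hdi
      refine riesz_sumSq y _ (2 * k - (g j).totalDegree) (fun q hq => h4 j q ?_) hsi (by omega)
      omega
    · fin_cases i
      · change (s (Sum.inr 0) * X 0).totalDegree ≤ 2 * k at hdi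
        change 0 ≤ riesz y (X 0 * s (Sum.inr 0))
        change ¬ s (Sum.inr 0) = 0 at hs0
        rw [totalDegree_mul_of_isDomain hs0 (X_ne_zero _), totalDegree_X] at hdi
        exact riesz_sumSq y _ (2 * k - 1) (fun q hq => h2 q (by omega)) hsi (by omega)
      · change (s (Sum.inr 1) * ((∑ i, X i ^ 2) - 1)).totalDegree ≤ 2 * k at hdi
        change 0 ≤ riesz y (((∑ i, X i ^ 2) - 1) * s (Sum.inr 1))
        exact (hsph _ hdi).ge
      · change (s (Sum.inr 2) * (1 - ∑ i, X i ^ 2)).totalDegree ≤ 2 * k at hdi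
        change 0 ≤ riesz y ((1 - ∑ i, X i ^ 2) * s (Sum.inr 2))
        have e1 : (1 - ∑ i, X i ^ 2 : MvPolynomial (Fin (n + 1)) ℝ) =
          -((∑ i, X i ^ 2) - 1) := by ring
        rw [e1, mul_neg, totalDegree_neg] at hdi
        rw [e1, neg_mul, riesz_neg, hsph _ hdi, neg_zero]

/-- Every point of `S` yields a Dirac moment sequence. -/
lemma semiS_subset_omegaRel {n : ℕ} {ι : Type*} [Fintype ι] (k : ℕ)
    (g : ι → MvPolynomial (Fin n) ℝ) : semiS g ⊆ omegaRel k g := by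
  intro x hx
  set v : Fin (n + 1) → ℝ := Fin.cons 1 x with hv
  have hpos : 0 < ∑ i, v i ^ 2 := by
    rw [Fin.sum_univ_succ]
    have : 0 ≤ ∑ i : Fin n, v i.succ ^ 2 := Finset.sum_nonneg fun i _ => sq_nonneg _
    simp only [hv, Fin.cons_zero] at *
    linarith
  set N := Real.sqrt (∑ i, v i ^ 2) with hN
  have hNpos : 0 < N := Real.sqrt_pos.mpr hpos
  have hN2 : N ^ 2 = ∑ i, v i ^ 2 := Real.sq_sqrt hpos.le
  set w : Fin (n + 1) → ℝ := N⁻¹ • v with hw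
  have hwi : ∀ i, N * w i = v i := by
    intro i
    simp only [hw, Pi.smul_apply, smul_eq_mul]
    field_simp
  refine ⟨fun α => N * ∏ i ∈ α.support, w i ^ α i, ?_, ?_, ?_, ?_, ?_, ?_⟩
  · rw [riesz_dirac, eval_X, hwi]; simp [hv]
  · intro i
    rw [riesz_dirac, eval_X, hwi]; simp [hv]
  · intro q _
    rw [riesz_dirac, map_pow]; positivity
  · intro q _
    have h0 : 0 ≤ w 0 := by
      simp only [hw, hv, Pi.smul_apply, smul_eq_mul, Fin.cons_zero]; positivity
    rw [riesz_dirac, map_mul, map_pow, eval_X]; positivity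
  · intro q _
    have hs : ∑ i, w i ^ 2 = 1 := by
      simp only [hw, Pi.smul_apply, smul_eq_mul, mul_pow]
      rw [← Finset.mul_sum, ← hN2]
      field_simp
    rw [riesz_dirac]
    simp [hs]
  · intro j q _
    have hj := hx j
    rw [riesz_dirac, map_mul, map_pow, hw, eval_homog]
    positivity

lemma eval_homog_nonneg_iff {n : ℕ} (f : MvPolynomial (Fin n) ℝ) (w : Fin (n + 1) → ℝ)
    (hw : 0 < w 0) (h : 0 ≤ eval w (homog f)) : 0 ≤ eval (fun i => w i.succ / w 0) f := by
  have he : w = w 0 • (Fin.cons 1 (fun i => w i.succ / w 0) : Fin (n + 1) → ℝ) := by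
    ext i
    refine Fin.cases ?_ (fun i => ?_) i
    · simp
    · simp only [Pi.smul_apply, Fin.cons_succ, smul_eq_mul]; field_simp
  rw [he, eval_homog] at h
  exact nonneg_of_mul_nonneg_right h (by positivity)

/-- Linear forms nonnegative on `S` (after dehomogenization) are nonnegative on `S̃ᶜ`. -/
lemma linear_nonneg_StC {n : ℕ} {ι : Type*} (g : ι → MvPolynomial (Fin n) ℝ)
    (hcl : closure (StO g) = StC g) (a : Fin (n + 1) → ℝ)
    (ha : ∀ x ∈ semiS g, 0 ≤ a 0 + ∑ i : Fin n, a i.succ * x i) :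
    ∀ w ∈ StC g, 0 ≤ ∑ i, a i * w i := by
  intro w hw
  rw [← hcl] at hw
  have hclosed : IsClosed {w : Fin (n + 1) → ℝ | 0 ≤ ∑ i, a i * w i} :=
    isClosed_le continuous_const (by fun_prop)
  refine closure_minimal ?_ hclosed hw
  rintro w ⟨h1, h2⟩
  have h := ha (fun i => w i.succ / w 0) fun j => eval_homog_nonneg_iff _ _ h2 (h1 j)
  have h3 := mul_nonneg h2.le h
  rw [mul_add, Finset.mul_sum] at h3
  change 0 ≤ ∑ i, a i * w i
  rw [Fin.sum_univ_succ]
  have e2 : ∑ i : Fin n, a i.succ * w i.succ =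
      ∑ i : Fin n, w 0 * (a i.succ * (w i.succ / w 0)) :=
    Finset.sum_congr rfl fun i _ => by field_simp
  rw [e2, mul_comm (a 0)]
  exact h3

/-- The core of the reverse inclusion. -/
lemma omegaRel_nonneg {n : ℕ} {ι : Type*} [Fintype ι] (k : ℕ)
    (g : ι → MvPolynomial (Fin n) ℝ) (hPP : ppBDR k g (StS g)) (a : Fin (n + 1) → ℝ)
    (ha : ∀ w ∈ StS g, 0 ≤ ∑ i, a i * w i) (z : Fin n → ℝ) (hz : z ∈ omegaRel k g) :
    0 ≤ a 0 + ∑ i : Fin n, a i.succ * z i := by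
  obtain ⟨y, hy0, hyi, h1, h2, h3, h4⟩ := hz
  have hval : ∀ c : Fin (n + 2) → ℝ,
      riesz y (C (c 0) + ∑ i : Fin (n + 1), C (c i.succ) * X i) =
        c 0 * riesz y 1 + (c 1 + ∑ i : Fin n, c i.succ.succ * z i) := by
    intro c
    have e : C (c 0) = C (c 0) * (1 : MvPolynomial (Fin (n + 1)) ℝ) := (mul_one _).symm
    rw [e, riesz_add, riesz_C_mul, riesz_sum, Fin.sum_univ_succ]
    simp only [riesz_C_mul, hy0, hyi, mul_one]
    rfl
  have hae : ∀ᵐ c : Fin (n + 2) → ℝ,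
      (∀ x ∈ StS g, 0 < c 0 + ∑ i : Fin (n + 1), c i.succ * x i) →
      (C (c 0) + ∑ i : Fin (n + 1), C (c i.succ) * X i) ∈ QMod k (tGens g) := by
    rw [MeasureTheory.ae_iff]
    unfold ppBDR at hPP
    convert hPP using 3
    ext c
    push Not
    rfl
  have hdense := MeasureTheory.Measure.dense_of_ae hae
  by_contra hneg
  push Not at hneg
  set A := a 0 + ∑ i : Fin n, a i.succ * z i with hA
  set r := riesz y 1 with hr
  let U : Set (Fin (n + 2) → ℝ) :=
    {c | c 0 * r + (c 1 + ∑ i : Fin n, c i.succ.succ * z i) < 0} ∩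
      {c | ∑ i : Fin (n + 1), |c i.succ - a i| < c 0}
  have hUo : IsOpen U := by
    refine IsOpen.inter ?_ ?_
    · exact isOpen_lt (by fun_prop) continuous_const
    · exact isOpen_lt (by fun_prop) (by fun_prop)
  have hUn : U.Nonempty := by
    set ε := -A / (2 * (|r| + 1)) with hε
    have hr1 : 0 < |r| + 1 := by positivity
    have hεpos : 0 < ε := div_pos (by linarith) (by positivity)
    have hεA : ε * (|r| + 1) = -A / 2 := by rw [hε]; field_simp
    refine ⟨Fin.cons ε a, ?_, ?_⟩
    · have e1 : (Fin.cons ε a : Fin (n + 2) → ℝ) 1 = a 0 := rfl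
      simp only [Set.mem_ofPred_eq, Fin.cons_zero, Fin.cons_succ, e1]
      rw [← hA]
      have := mul_le_mul_of_nonneg_left (le_abs_self r) hεpos.le
      nlinarith
    · simpa using hεpos
  obtain ⟨c, hc, hcU⟩ := hdense.exists_mem_open hUo hUn
  have hmem := hc (by
    intro x hx
    have hx1 : ∀ i, |x i| ≤ 1 := by
      intro i
      rw [← sq_le_one_iff_abs_le_one, ← hx.2.2]
      exact Finset.single_le_sum (f := fun i => x i ^ 2) (fun i _ => sq_nonneg _)
        (Finset.mem_univ i)
    have hax := ha x hx
    have hb : -∑ i : Fin (n + 1), |c i.succ - a i| ≤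
        ∑ i : Fin (n + 1), (c i.succ - a i) * x i := by
      rw [← Finset.sum_neg_distrib]
      refine Finset.sum_le_sum fun i _ => ?_
      have hh : |(c i.succ - a i) * x i| ≤ |c i.succ - a i| := by
        rw [abs_mul]
        exact mul_le_of_le_one_right (abs_nonneg _) (hx1 i)
      exact (neg_le_neg hh).trans (neg_abs_le _)
    simp only [sub_mul, Finset.sum_sub_distrib] at hb
    have := hcU.2
    simp only [Set.mem_ofPred_eq] at this
    linarith)
  have hfin := riesz_QMod k g y h1 h2 h3 h4 hmem
  rw [hval] at hfin
  exact absurd hcU.1 (not_lt.mpr hfin)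

/-- Theorem 4.3: if `S` is closed at infinity and the PP-BDR property holds with a common
order `k'` for every orthant piece `S̃_e` (with generating set `G̃_e`, where
`G_e = {g₁,…,g_m, (-1)^{e₁}X₁,…,(-1)^{eₙ}Xₙ}`), then
`closure (conv S) = closure (conv (⋃ₑ Ω_{k'}(G̃_e)))`; in particular `closure (conv S)` is
the closure of a projected spectrahedron. -/
theorem stmt15 (n m : ℕ) (g : Fin m → MvPolynomial (Fin n) ℝ)
    (hclosedinf : closure (StO g) = StC g) (k' : ℕ)
    (hPP : ∀ e : Fin n → Fin 2,
      ppBDR k' (Sum.elim g fun j : Fin n =>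
          (-1 : MvPolynomial (Fin n) ℝ) ^ (e j : ℕ) * X j)
        (StS (Sum.elim g fun j : Fin n =>
          (-1 : MvPolynomial (Fin n) ℝ) ^ (e j : ℕ) * X j))) :
    closure (convexHull ℝ (semiS g)) =
      closure (convexHull ℝ (⋃ e : Fin n → Fin 2,
        omegaRel k' (Sum.elim g fun j : Fin n =>
          (-1 : MvPolynomial (Fin n) ℝ) ^ (e j : ℕ) * X j))) := by
  apply Set.Subset.antisymm
  · refine closure_mono (convexHull_mono ?_)
    intro x hx
    rw [Set.mem_iUnion]
    refine ⟨fun j => if 0 ≤ x j then 0 else 1, semiS_subset_omegaRel _ _ ?_⟩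
    rintro (j | j)
    · exact hx j
    · by_cases h : 0 ≤ x j
      · simp [h]
      · simp [h]; linarith
  · refine closure_minimal (convexHull_min ?_ (convex_convexHull ℝ _).closure) isClosed_closure
    refine Set.iUnion_subset fun e z hz => ?_
    by_contra hzn
    obtain ⟨f, u, hfu, hfb⟩ := geometric_hahn_banach_point_closed
      (convex_convexHull ℝ (semiS g)).closure isClosed_closure hzn
    have hf : ∀ x : Fin n → ℝ, f x = ∑ i, f (Pi.single i 1) * x i := by
      intro x
      conv_lhs => rw [pi_eq_sum_univ' x]
      rw [map_sum]
      refine Finset.sum_congr rfl fun i _ => ?_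
      rw [map_smul, smul_eq_mul, mul_comm]
    set a : Fin (n + 1) → ℝ := Fin.cons (-u) (fun i => f (Pi.single i 1)) with ha
    have key : ∀ x : Fin n → ℝ, a 0 + ∑ i : Fin n, a i.succ * x i = f x - u := by
      intro x
      rw [hf x]
      simp only [ha, Fin.cons_zero, Fin.cons_succ]
      ring
    have hlin := linear_nonneg_StC g hclosedinf a (by
      intro x hx
      rw [key]
      have := hfb x (subset_closure (subset_convexHull ℝ _ hx))
      linarith)
    have := omegaRel_nonneg k' _ (hPP e) a (fun w hw => hlin w
      ⟨fun j => hw.1 (Sum.inl j), hw.2.1⟩) z hz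
    rw [key] at this
    linarith
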